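/- In any category C with objects X, Y and an index type I, if C has a product P of I-many copies of Y, and f, g : X ⟶ Y are two distinct morphisms, then there is an injection from the type of functions I → Bool into the type of morphisms X ⟶ P (obtained by choosing, for each coordinate i, either f or g as the component into the i-th projection). -/

import Mathlib

open CategoryTheory CategoryTheory.Limits

theorem freyd_injection {C : Type u} [Category.{v} C] {X Y : C} (I : Type w)
    [HasProduct (fun _ : I => Y)] (f g : X ⟶ Y) (hfg : f ≠ g) :
    Function.Injective
      (fun b : I → Bool => Pi.lift (fun i => if b i then f else g) : (I → Bool) → (X ⟶ ∏ᶜ (fun _ : I => Y))) := by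
  intro b c h
  funext i
  have hi := congrArg (fun k => k ≫ Pi.π (fun _ : I => Y) i) h
  simp only [limit.lift_π, Fan.mk_π_app] at hi
  cases hb : b i <;> cases hc : c i <;> simp_all
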